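/- Let 𝔫 be a finite alphabet. The set T* ⊆ K(𝔫^ℤ) of Toeplitz subshifts over 𝔫 with separated holes is a Borel subset of K(𝔫^ℤ), and the topological conjugacy relation on T* is hyperfinite: there exists an increasing sequence F_0 ⊆ F_1 ⊆ ⋯ of finite Borel equivalence relations on T* whose union is the relation {(O,O') ∈ T* × T* : O and O' are topologically conjugate}. -/

import Mathlib

open Filter Topology TopologicalSpace Set

/- Endow the product space `𝔫^ℤ` with (a) metric compatible with the product topology, so
that the hyperspace `K(𝔫^ℤ)` carries the Hausdorff metric topology. -/
attribute [local instance] PiCountable.metricSpace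

/-- The Borel σ-algebra on the hyperspace `K(𝔫^ℤ)`. -/
noncomputable local instance (A : Type) [MetricSpace A] :
    MeasurableSpace (NonemptyCompacts (ℤ → A)) := borel _

/-- The left-shift map on bi-infinite sequences. -/
def shiftMap (A : Type) (x : ℤ → A) : ℤ → A := fun i => x (i + 1)

/-- `Per p x` is the set of indices `i` at which `x` is periodic with period `p`. -/
def Per (A : Type) (p : ℕ) (x : ℤ → A) : Set ℤ := {i : ℤ | ∀ k : ℤ, x (i + p * k) = x i}

/-- A sequence is periodic if it is invariant under shifting by some `p ≥ 1`. -/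
def IsPeriodicSeq (A : Type) (x : ℤ → A) : Prop := ∃ p : ℕ, 1 ≤ p ∧ ∀ i : ℤ, x (i + p) = x i

/-- A (non-periodic) Toeplitz sequence: every symbol occurs periodically. -/
def IsToeplitzSeq (A : Type) (x : ℤ → A) : Prop :=
  ¬ IsPeriodicSeq A x ∧ ∀ i : ℤ, ∃ j : ℕ, 1 ≤ j ∧ ∀ k : ℤ, x (i + k * j) = x i

/-- `p` is an essential period of `x`. -/
def IsEssentialPeriod (A : Type) (x : ℤ → A) (p : ℕ) : Prop :=
  1 ≤ p ∧ (Per A p x).Nonempty ∧ ∀ q : ℕ, 1 ≤ q → q < p → Per A p x ≠ Per A q x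

/-- The closure of the forward `σ`-orbit of `x`. -/
def orbitClosure (A : Type) [TopologicalSpace A] (x : ℤ → A) : Set (ℤ → A) :=
  closure {y | ∃ n : ℕ, y = (shiftMap A)^[n] x}

/-- Topological conjugacy of two subshifts: a shift-commuting homeomorphism. -/
def IsTopConj (A : Type) [TopologicalSpace A] (O O' : Set (ℤ → A)) : Prop :=
  ∃ e : O ≃ₜ O', ∀ x y : O, (y : ℤ → A) = shiftMap A (x : ℤ → A) →
    (e y : ℤ → A) = shiftMap A (e x : ℤ → A)


/-- A Toeplitz sequence has separated holes: for some (equivalently, any) factorization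
`(u_i)` of its scale, the minimal distance between distinct `u_i`-holes tends to `∞`. -/
def HasSeparatedHoles (A : Type) (x : ℤ → A) : Prop :=
  ∃ u : ℕ → ℕ, (∀ i, 1 ≤ u i) ∧ (∀ i, u i ∣ u (i + 1)) ∧
    (∀ i, ∃ e : ℕ, IsEssentialPeriod A x e ∧ u i ∣ e) ∧
    (∀ e : ℕ, IsEssentialPeriod A x e → ∃ i, e ∣ u i) ∧
    (∀ N : ℤ, ∃ I : ℕ, ∀ i : ℕ, I ≤ i → ∀ s t : ℤ, s ≠ t →
      s ∉ Per A (u i) x → t ∉ Per A (u i) x → N ≤ |s - t|)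

/-- `T*`: the set of Toeplitz subshifts with separated holes, inside `K(𝔫^ℤ)`. -/
def ToeplitzSepHoles (A : Type) [MetricSpace A] : Set (NonemptyCompacts (ℤ → A)) :=
  {K | ∃ x : ℤ → A, IsToeplitzSeq A x ∧ HasSeparatedHoles A x ∧
    (K : Set (ℤ → A)) = orbitClosure A x}

section Translation

variable {A : Type}

/-- The seqShift of a bi-infinite sequence by an arbitrary integer. -/
def seqShift (n : ℤ) (x : ℤ → A) : ℤ → A := fun i => x (i + n)

@[simp]
theorem seqShift_apply (n : ℤ) (x : ℤ → A) (i : ℤ) : seqShift n x i = x (i + n) := rfl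

@[simp]
theorem seqShift_zero (x : ℤ → A) : seqShift 0 x = x := by
  ext i; simp

theorem seqShift_seqShift (m n : ℤ) (x : ℤ → A) :
    seqShift m (seqShift n x) = seqShift (m + n) x := by
  ext i; simp [add_assoc]

theorem shiftMap_iterate (n : ℕ) (x : ℤ → A) : (shiftMap A)^[n] x = seqShift n x := by
  induction n with
  | zero => simp
  | succ n ih =>
    rw [Function.iterate_succ_apply', ih]
    ext i
    simp only [shiftMap, seqShift_apply]
    congr 1
    push_cast
    ring

/-- The restriction of a sequence to the window `[-m, m]`. -/
def window (m : ℕ) (x : ℤ → A) : Finset.Icc (-(m : ℤ)) m → A := fun i => x i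

theorem window_eq_iff {m : ℕ} {x y : ℤ → A} :
    window m x = window m y ↔ ∀ i : ℤ, |i| ≤ m → x i = y i := by
  simp only [funext_iff, window, Subtype.forall, Finset.mem_Icc, abs_le]

theorem continuous_seqShift [TopologicalSpace A] (n : ℤ) :
    Continuous (seqShift n : (ℤ → A) → ℤ → A) :=
  continuous_pi fun i => continuous_apply (i + n)

theorem continuous_window [TopologicalSpace A] (m : ℕ) :
    Continuous (window m : (ℤ → A) → _) :=
  continuous_pi fun i => continuous_apply (i : ℤ)

theorem mem_closure_iff_window [TopologicalSpace A] [DiscreteTopology A] {S : Set (ℤ → A)}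
    {z : ℤ → A} : z ∈ closure S ↔ ∀ m : ℕ, ∃ y ∈ S, window m y = window m z := by
  constructor
  · intro hz m
    have ho : IsOpen (window m ⁻¹' {window m z}) :=
      (isOpen_discrete _).preimage (continuous_window m)
    obtain ⟨y, hy, hyS⟩ := mem_closure_iff.1 hz _ ho rfl
    exact ⟨y, hyS, hy⟩
  · intro h
    refine mem_closure_iff.2 fun U hU hz => ?_
    obtain ⟨I, u, hu, hIU⟩ := isOpen_pi_iff.1 hU z hz
    obtain ⟨y, hyS, hy⟩ := h (I.sup Int.natAbs)
    refine ⟨y, hIU fun i hi => ?_, hyS⟩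
    have hle : i.natAbs ≤ I.sup Int.natAbs := Finset.le_sup (f := Int.natAbs) hi
    rw [window_eq_iff.1 hy i (by rw [Int.abs_eq_natAbs]; exact_mod_cast hle)]
    exact (hu i hi).2

theorem orbitClosure_eq [TopologicalSpace A] (x : ℤ → A) :
    orbitClosure A x = closure (range fun n : ℕ => seqShift n x) := by
  unfold orbitClosure
  congr 1
  ext y
  simp [shiftMap_iterate, eq_comm]

end Translation

section Periods

variable {A : Type}

theorem mem_Per {p : ℕ} {x : ℤ → A} {i : ℤ} :
    i ∈ Per A p x ↔ ∀ k : ℤ, x (i + p * k) = x i := Iff.rfl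

theorem mem_Per_seqShift {p : ℕ} {x : ℤ → A} {i n : ℤ} :
    i ∈ Per A p (seqShift n x) ↔ i + n ∈ Per A p x := by
  simp only [mem_Per, seqShift_apply, add_right_comm]

theorem add_mul_mem_Per_iff {p : ℕ} {x : ℤ → A} {i : ℤ} (k : ℤ) :
    i + p * k ∈ Per A p x ↔ i ∈ Per A p x := by
  have key : ∀ (i k : ℤ), i ∈ Per A p x → i + p * k ∈ Per A p x := fun i k h l => by
    rw [add_assoc, ← mul_add, h, h]
  refine ⟨fun h => ?_, key i k⟩
  simpa using key _ (-k) h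

theorem Per_subset_of_dvd {p q : ℕ} (h : p ∣ q) (x : ℤ → A) : Per A p x ⊆ Per A q x := by
  obtain ⟨c, rfl⟩ := h
  intro i hi k
  push_cast
  rw [mul_assoc, hi]

theorem isClosed_setOf_mem_Per [TopologicalSpace A] [DiscreteTopology A] (p : ℕ) (i : ℤ) :
    IsClosed {x : ℤ → A | i ∈ Per A p x} := by
  simp only [mem_Per, ofPred_forall]
  exact isClosed_iInter fun k => isClosed_eq (continuous_apply _) (continuous_apply _)

theorem Per_subset_Per_gcd {p q : ℕ} {x : ℤ → A} (h : Per A p x ⊆ Per A q x) :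
    Per A p x ⊆ Per A (p.gcd q) x := by
  intro i hi k
  have : (i + (p.gcd q : ℕ) * k : ℤ) = (i + p * (p.gcdA q * k)) + q * (p.gcdB q * k) := by
    rw [Nat.gcd_eq_gcd_ab]; ring
  rw [this, h ((add_mul_mem_Per_iff _).2 hi), hi]

/-- An essential period divides every period whose skeleton is finer. -/
theorem IsEssentialPeriod.dvd {x : ℤ → A} {e q : ℕ} (he : IsEssentialPeriod A x e)
    (h : Per A e x ⊆ Per A q x) : e ∣ q := by
  have hpos : 0 < e.gcd q := Nat.gcd_pos_of_pos_left _ he.1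
  have hle : e.gcd q ≤ e := Nat.gcd_le_left _ he.1
  rcases hle.lt_or_eq with hlt | heq
  · exact absurd ((Per_subset_Per_gcd h).antisymm
      (Per_subset_of_dvd (Nat.gcd_dvd_left e q) x)) (he.2.2 _ hpos hlt)
  · exact Nat.gcd_eq_left_iff_dvd.1 heq

theorem exists_isEssentialPeriod {x : ℤ → A} {p : ℕ} (hp : 1 ≤ p) (h : (Per A p x).Nonempty) :
    ∃ e, IsEssentialPeriod A x e ∧ Per A e x = Per A p x := by
  classical
  have hex : ∃ e, 1 ≤ e ∧ Per A e x = Per A p x := ⟨p, hp, rfl⟩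
  have hs := Nat.find_spec hex
  refine ⟨Nat.find hex, ⟨hs.1, by rwa [hs.2], fun q hq hlt heq => ?_⟩, hs.2⟩
  exact Nat.find_min hex hlt ⟨hq, heq.symm.trans hs.2⟩

/-- Distinct `p`-holes of `x` are at distance at least `N`. -/
def HolesSeparated (N : ℤ) (p : ℕ) (x : ℤ → A) : Prop :=
  ∀ s t : ℤ, s ≠ t → s ∉ Per A p x → t ∉ Per A p x → N ≤ |s - t|

theorem HolesSeparated.of_dvd {N : ℤ} {p q : ℕ} {x : ℤ → A} (h : HolesSeparated N p x)
    (hpq : p ∣ q) : HolesSeparated N q x := fun s t hst hs ht =>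
  h s t hst (fun h' => hs (Per_subset_of_dvd hpq x h')) fun h' => ht (Per_subset_of_dvd hpq x h')

theorem HolesSeparated.seqShift {N : ℤ} {p : ℕ} {x : ℤ → A} (h : HolesSeparated N p x) (n : ℤ) :
    HolesSeparated N p (seqShift n x) := fun s t hst hs ht => by
  rw [mem_Per_seqShift] at hs ht
  simpa using h (s + n) (t + n) (by simpa using hst) hs ht

theorem isClosed_holesSeparated [TopologicalSpace A] [DiscreteTopology A] (N : ℤ) (p : ℕ) :
    IsClosed {x : ℤ → A | HolesSeparated N p x} := by
  have : {x : ℤ → A | HolesSeparated N p x} = ⋂ (s : ℤ) (t : ℤ) (_ : s ≠ t ∧ ¬ N ≤ |s - t|),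
      ({x | s ∈ Per A p x} ∪ {x | t ∈ Per A p x}) := by
    ext x
    simp only [HolesSeparated, mem_ofPred_eq, mem_iInter, mem_union]
    refine forall_congr' fun s => forall_congr' fun t => ?_
    tauto
  rw [this]
  exact isClosed_iInter fun s => isClosed_iInter fun t => isClosed_iInter fun _ =>
    (isClosed_setOf_mem_Per p s).union (isClosed_setOf_mem_Per p t)

end Periods

section SeparatedMinimal

variable {A : Type}

/-- A description of Toeplitz subshifts with separated holes that refers only to the cylinder
sets met by the subshift and to closed sets containing it. -/
structure IsSeparatedMinimal (K : Set (ℤ → A)) : Prop where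
  shift_mem : ∀ x ∈ K, seqShift 1 x ∈ K
  recurrent : ∀ m : ℕ, ∀ x ∈ K, ∃ t : ℕ, ∀ y ∈ K, ∃ j ≤ t,
    window m (seqShift (j : ℕ) y) = window m x
  aperiodic : ∀ p : ℕ, 1 ≤ p → ∃ x ∈ K, ∃ i : ℤ, x (i + p) ≠ x i
  separated : ∀ N : ℤ, ∃ n : ℕ, ∀ x ∈ K, HolesSeparated N n.factorial x

theorem IsToeplitzSeq.exists_window_subset_Per {x : ℤ → A} (hx : IsToeplitzSeq A x) (n : ℤ)
    (m : ℕ) : ∃ p : ℕ, 1 ≤ p ∧ ∀ i : ℤ, |i| ≤ m → i + n ∈ Per A p x := by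
  choose j hj hjx using hx.2
  refine ⟨∏ i ∈ Finset.Icc (-(m : ℤ)) m, j (i + n), Nat.one_le_iff_ne_zero.2
    (Finset.prod_ne_zero_iff.2 fun i _ => Nat.one_le_iff_ne_zero.1 (hj _)), fun i hi => ?_⟩
  have hd : j (i + n) ∣ ∏ i ∈ Finset.Icc (-(m : ℤ)) m, j (i + n) :=
    Finset.dvd_prod_of_mem (fun i => j (i + n)) (Finset.mem_Icc.2 (abs_le.1 hi))
  refine Per_subset_of_dvd hd x fun k => ?_
  rw [mul_comm]
  exact hjx _ k

theorem IsToeplitzSeq.isSeparatedMinimal [TopologicalSpace A] [DiscreteTopology A]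
    {x : ℤ → A} (hx : IsToeplitzSeq A x) (hs : HasSeparatedHoles A x) :
    IsSeparatedMinimal (orbitClosure A x) := by
  rw [orbitClosure_eq]
  have hmem : ∀ n : ℕ, seqShift n x ∈ closure (range fun n : ℕ => seqShift (n : ℤ) x) :=
    fun n => subset_closure ⟨n, rfl⟩
  refine ⟨fun z hz => ?_, fun m z hz => ?_, fun p hp => ?_, fun N => ?_⟩
  · refine MapsTo.closure (f := seqShift 1) ?_ (continuous_seqShift 1) hz
    rintro _ ⟨n, rfl⟩
    refine ⟨n + 1, ?_⟩
    simp only [seqShift_seqShift]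
    congr 1
    push_cast
    ring
  · obtain ⟨_, ⟨n, rfl⟩, hn⟩ := mem_closure_iff_window.1 hz m
    obtain ⟨p, hp, hper⟩ := hx.exists_window_subset_Per n m
    refine ⟨p, ?_⟩
    have hcl : IsClosed {y : ℤ → A | ∃ j ≤ p, window m (seqShift (j : ℕ) y) = window m z} := by
      have : {y : ℤ → A | ∃ j ≤ p, window m (seqShift (j : ℕ) y) = window m z} =
          ⋃ j ∈ Finset.range (p + 1), {y | window m (seqShift (j : ℕ) y) = window m z} := by
        ext y; simp
      rw [this]
      exact isClosed_biUnion_finset fun j _ =>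
        isClosed_eq ((continuous_window m).comp (continuous_seqShift _)) continuous_const
    refine fun y hy => closure_minimal ?_ hcl hy
    rintro _ ⟨l, rfl⟩
    have hp0 : (0 : ℤ) < p := by exact_mod_cast hp
    have h0 := Int.emod_nonneg ((n : ℤ) - l) hp0.ne'
    have h1 := Int.emod_lt_of_pos ((n : ℤ) - l) hp0
    refine ⟨(((n : ℤ) - l) % p).toNat, by omega, ?_⟩
    rw [← hn, window_eq_iff]
    intro i hi
    simp only [seqShift_apply, Int.toNat_of_nonneg h0]
    have h2 : i + ((n : ℤ) - l) % p + l = i + n + p * (-(((n : ℤ) - l) / p)) := by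
      have := Int.emod_add_mul_ediv ((n : ℤ) - l) p
      linarith
    rw [h2, hper i hi]
  · by_contra! h
    exact hx.1 ⟨p, hp, h x (by simpa using hmem 0)⟩
  · obtain ⟨u, hu1, -, -, -, hu⟩ := hs
    obtain ⟨I, hI⟩ := hu N
    have hsep : HolesSeparated N (u I).factorial x :=
      HolesSeparated.of_dvd (hI I le_rfl) (Nat.dvd_factorial (hu1 I) le_rfl)
    refine ⟨u I, fun y hy => closure_minimal ?_ (isClosed_holesSeparated N _) hy⟩
    rintro _ ⟨n, rfl⟩
    exact hsep.seqShift n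

namespace IsSeparatedMinimal

variable {K : Set (ℤ → A)}

theorem seqShift_natCast_mem (hK : IsSeparatedMinimal K) {x : ℤ → A} (hx : x ∈ K) (n : ℕ) :
    seqShift n x ∈ K := by
  induction n with
  | zero => simpa using hx
  | succ n ih =>
    have := hK.shift_mem _ ih
    rw [seqShift_seqShift] at this
    convert this using 2
    push_cast
    ring

/-- Every forward orbit is dense. -/
theorem eq_orbitClosure [TopologicalSpace A] [DiscreteTopology A] (hK : IsSeparatedMinimal K)
    (hc : IsClosed K) {x : ℤ → A} (hx : x ∈ K) : K = orbitClosure A x := by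
  rw [orbitClosure_eq]
  refine Subset.antisymm (fun z hz => mem_closure_iff_window.2 fun m => ?_)
    (closure_minimal ?_ hc)
  · obtain ⟨t, ht⟩ := hK.recurrent m z hz
    obtain ⟨j, -, hj⟩ := ht x hx
    exact ⟨_, ⟨j, rfl⟩, hj⟩
  · rintro _ ⟨n, rfl⟩
    exact hK.seqShift_natCast_mem hx n

theorem seqShift_mem [TopologicalSpace A] [DiscreteTopology A] (hK : IsSeparatedMinimal K)
    (hc : IsClosed K) {x : ℤ → A} (hx : x ∈ K) (n : ℤ) : seqShift n x ∈ K := by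
  have hinv : ∀ x ∈ K, seqShift (-1) x ∈ K := by
    intro x hx
    rw [← hc.closure_eq, mem_closure_iff_window]
    intro m
    obtain ⟨t, ht⟩ := hK.recurrent (m + 1) x hx
    obtain ⟨j, -, hj⟩ := ht _ (hK.shift_mem x hx)
    refine ⟨seqShift j x, hK.seqShift_natCast_mem hx j, window_eq_iff.2 fun i hi => ?_⟩
    have := window_eq_iff.1 hj (i - 1) (by
      push_cast
      rw [abs_le] at hi ⊢
      omega)
    simp only [seqShift_apply] at this ⊢
    rw [← sub_eq_add_neg, ← this]
    congr 1
    ring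
  have hneg : ∀ n : ℕ, seqShift (-n) x ∈ K := by
    intro n
    induction n with
    | zero => simpa using hx
    | succ n ih =>
      have := hinv _ ih
      rw [seqShift_seqShift] at this
      convert this using 2
      push_cast
      ring
  obtain ⟨k, rfl | rfl⟩ := n.eq_nat_or_neg
  · exact hK.seqShift_natCast_mem hx k
  · exact hneg k

theorem exists_dvd_window_subset_Per (hK : IsSeparatedMinimal K) {x : ℤ → A} (hx : x ∈ K)
    {P : ℕ} (hP : 1 ≤ P) (m : ℕ) : ∃ Q k : ℕ, 1 ≤ Q ∧ P ∣ Q ∧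
      ∀ i : ℤ, |i| ≤ m → i ∈ Per A Q (seqShift (P * k : ℕ) x) := by
  obtain ⟨n, hn⟩ := hK.separated (P * (2 * m + 1) + 2 * m + 1)
  have hsep := (hn x hx).of_dvd (Nat.dvd_mul_right n.factorial P)
  refine ⟨n.factorial * P, ?_⟩
  by_contra! hcon
  have hpos : 1 ≤ n.factorial * P := Nat.mul_pos n.factorial_pos hP
  obtain ⟨i, hi, hi'⟩ := hcon 0 hpos (Nat.dvd_mul_left _ _)
  obtain ⟨j, hj, hj'⟩ := hcon (2 * m + 1) hpos (Nat.dvd_mul_left _ _)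
  rw [mem_Per_seqShift] at hi' hj'
  push_cast at hi' hj'
  have hP' : (2 * m + 1 : ℤ) ≤ P * (2 * m + 1) :=
    le_mul_of_one_le_left (by positivity) (by exact_mod_cast hP)
  rw [abs_le] at hi hj
  have := hsep (j + P * (2 * m + 1)) (i + P * 0)
    (by rw [mul_zero]; intro h; linarith [hi.2, hj.1]) hj' hi'
  rw [mul_zero, add_zero, abs_of_pos (by linarith [hi.2, hj.1])] at this
  linarith [hi.1, hj.2]

theorem exists_locally_periodic [TopologicalSpace A] [DiscreteTopology A]
    (hK : IsSeparatedMinimal K) (hc : IsCompact K) (hne : K.Nonempty) :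
    ∃ x ∈ K, ∀ i : ℤ, ∃ j : ℕ, 1 ≤ j ∧ i ∈ Per A j x := by
  obtain ⟨x₀, hx₀⟩ := hne
  let S := {s : ℕ × (ℤ → A) // 1 ≤ s.1 ∧ s.2 ∈ K}
  have hstep : ∀ (m : ℕ) (s : S), ∃ s' : S, s.1.1 ∣ s'.1.1 ∧
      (∃ k : ℤ, s'.1.2 = seqShift (s.1.1 * k) s.1.2) ∧
      ∀ i : ℤ, |i| ≤ m → i ∈ Per A s'.1.1 s'.1.2 := by
    rintro m ⟨⟨P, x⟩, hP, hx⟩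
    obtain ⟨Q, k, hQ, hPQ, h⟩ := hK.exists_dvd_window_subset_Per hx hP m
    exact ⟨⟨(Q, seqShift (P * k : ℕ) x), hQ, hK.seqShift_natCast_mem hx _⟩, hPQ,
      ⟨k, by push_cast; rfl⟩, h⟩
  choose next hdvd hshift hper using hstep
  let s : ℕ → S := fun n => Nat.rec ⟨(1, x₀), le_rfl, hx₀⟩ next n
  have hkeep : ∀ m n : ℕ, m + 1 ≤ n → (s (m + 1)).1.1 ∣ (s n).1.1 ∧
      ∀ i : ℤ, |i| ≤ m → i ∈ Per A (s (m + 1)).1.1 (s n).1.2 := by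
    intro m n hmn
    induction n, hmn using Nat.le_induction with
    | base => exact ⟨dvd_rfl, hper m (s m)⟩
    | succ n _ ih =>
      refine ⟨ih.1.trans (hdvd n (s n)), fun i hi => ?_⟩
      obtain ⟨k, hk⟩ := hshift n (s n)
      obtain ⟨c, hc⟩ := ih.1
      change i ∈ Per A _ (next n (s n)).1.2
      rw [hk, mem_Per_seqShift, hc]
      push_cast
      rw [mul_assoc, add_mul_mem_Per_iff]
      exact ih.2 i hi
  obtain ⟨x, hxK, hx⟩ := hc.exists_mapClusterPt (f := atTop) (u := fun n => (s n).1.2)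
    (by simp [fun n => (s n).2.2])
  refine ⟨x, hxK, fun i => ⟨(s (i.natAbs + 1)).1.1, (s (i.natAbs + 1)).2.1, ?_⟩⟩
  refine (isClosed_setOf_mem_Per (A := A) (s (i.natAbs + 1)).1.1 i).mem_of_mapClusterPt hx ?_
  filter_upwards [eventually_ge_atTop (i.natAbs + 1)] with n hn
  exact (hkeep _ n hn).2 i (by simp)

theorem hasSeparatedHoles (hK : IsSeparatedMinimal K) {x : ℤ → A} (hx : x ∈ K)
    (hper : ∀ i : ℤ, ∃ j : ℕ, 1 ≤ j ∧ i ∈ Per A j x) : HasSeparatedHoles A x := by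
  obtain ⟨n₀, hn₀, h0⟩ := hper 0
  have hne : ∀ i, (Per A (n₀ + i).factorial x).Nonempty := fun i =>
    ⟨0, Per_subset_of_dvd (Nat.dvd_factorial hn₀ (Nat.le_add_right _ _)) x h0⟩
  choose u hu hPer using fun i => exists_isEssentialPeriod (Nat.factorial_pos _) (hne i)
  refine ⟨u, fun i => (hu i).1, fun i => (hu i).dvd ?_, fun i => ⟨u i, hu i, dvd_rfl⟩,
    fun e he => ⟨e, he.dvd ?_⟩, fun N => ?_⟩
  · rw [hPer, hPer]
    exact Per_subset_of_dvd (Nat.factorial_dvd_factorial (by omega)) x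
  · rw [hPer]
    exact Per_subset_of_dvd (Nat.dvd_factorial he.1 (Nat.le_add_left _ _)) x
  · obtain ⟨n, hn⟩ := hK.separated N
    refine ⟨n, fun i hi s t hst => ?_⟩
    rw [hPer]
    exact ((hn x hx).of_dvd (Nat.factorial_dvd_factorial (by omega))) s t hst

end IsSeparatedMinimal

theorem mem_toeplitzSepHoles_iff [Fintype A] [MetricSpace A] (K : NonemptyCompacts (ℤ → A)) :
    K ∈ ToeplitzSepHoles A ↔ IsSeparatedMinimal (K : Set (ℤ → A)) := by
  constructor
  · rintro ⟨x, hx, hs, hK⟩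
    rw [hK]
    exact hx.isSeparatedMinimal hs
  · intro hK
    obtain ⟨x, hx, hper⟩ := hK.exists_locally_periodic K.isCompact K.nonempty
    have hKx := hK.eq_orbitClosure K.isCompact.isClosed hx
    refine ⟨x, ⟨?_, fun i => ?_⟩, hK.hasSeparatedHoles hx hper, hKx⟩
    · rintro ⟨p, hp, hpx⟩
      obtain ⟨y, hy, i, hi⟩ := hK.aperiodic p hp
      have hcl : IsClosed {y : ℤ → A | y (i + p) = y i} :=
        isClosed_eq (continuous_apply _) (continuous_apply _)
      rw [hKx, orbitClosure_eq] at hy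
      refine hi (closure_minimal ?_ hcl hy)
      rintro _ ⟨n, rfl⟩
      simpa [add_right_comm] using hpx (i + n)
    · obtain ⟨j, hj, h⟩ := hper i
      exact ⟨j, hj, fun k => by rw [mul_comm]; exact h k⟩

end SeparatedMinimal

section HoleMatching

variable {A : Type}

/-- `M` is a `p`-periodic order-preserving matching between the `p`-holes of `x` and those of `y`
such that, at matched positions, the values of `x` and `y` determine each other. -/
structure HoleMatching (p : ℕ) (x y : ℤ → A) (M : ℤ → ℤ → Prop) : Prop where
  add_mul : ∀ i j, M i j → ∀ k : ℤ, M (i + p * k) (j + p * k)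
  left_total : ∀ i, i ∈ Per A p x ∨ ∃ j, M i j
  right_total : ∀ j, j ∈ Per A p y ∨ ∃ i, M i j
  eq_iff : ∀ i j, M i j → ∀ k : ℤ, x (i + p * k) = x i ↔ y (j + p * k) = y j
  lt_iff : ∀ i j i' j', M i j → M i' j' → (i < i' ↔ j < j')

/-- The `p`-periodic relation generated by a finite set of pairs. -/
def periodicRel (p : ℕ) (G : Finset (ℤ × ℤ)) (i j : ℤ) : Prop :=
  ∃ g ∈ G, ∃ k : ℤ, i = g.1 + p * k ∧ j = g.2 + p * k

namespace HoleMatching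

variable {p : ℕ} {x y z : ℤ → A} {M N : ℤ → ℤ → Prop}

theorem refl (p : ℕ) (x : ℤ → A) : HoleMatching p x x Eq where
  add_mul _ _ h _ := by rw [h]
  left_total i := Or.inr ⟨i, rfl⟩
  right_total i := Or.inr ⟨i, rfl⟩
  eq_iff _ _ h _ := by rw [h]
  lt_iff _ _ _ _ h h' := by rw [h, h']

theorem symm (h : HoleMatching p x y M) : HoleMatching p y x (fun j i => M i j) where
  add_mul j i hij k := h.add_mul i j hij k
  left_total := h.right_total
  right_total := h.left_total
  eq_iff j i hij k := (h.eq_iff i j hij k).symm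
  lt_iff j i j' i' hij hij' := (h.lt_iff i j i' j' hij hij').symm

theorem mem_Per_iff (h : HoleMatching p x y M) {i j : ℤ} (hij : M i j) :
    i ∈ Per A p x ↔ j ∈ Per A p y :=
  forall_congr' fun k => h.eq_iff i j hij k

theorem comp (h : HoleMatching p x y M) (h' : HoleMatching p y z N) :
    HoleMatching p x z (fun i l => ∃ j, M i j ∧ N j l) where
  add_mul := by
    rintro i l ⟨j, hij, hjl⟩ k
    exact ⟨_, h.add_mul i j hij k, h'.add_mul j l hjl k⟩
  left_total i := by
    refine or_iff_not_imp_left.2 fun hi => ?_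
    obtain ⟨j, hij⟩ := (h.left_total i).resolve_left hi
    obtain ⟨l, hjl⟩ := (h'.left_total j).resolve_left fun hj => hi ((h.mem_Per_iff hij).2 hj)
    exact ⟨l, j, hij, hjl⟩
  right_total l := by
    refine or_iff_not_imp_left.2 fun hl => ?_
    obtain ⟨j, hjl⟩ := (h'.right_total l).resolve_left hl
    obtain ⟨i, hij⟩ := (h.right_total j).resolve_left fun hj => hl ((h'.mem_Per_iff hjl).1 hj)
    exact ⟨i, j, hij, hjl⟩
  eq_iff := by
    rintro i l ⟨j, hij, hjl⟩ k
    rw [h.eq_iff i j hij, h'.eq_iff j l hjl]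
  lt_iff := by
    rintro i l i' l' ⟨j, hij, hjl⟩ ⟨j', hij', hjl'⟩
    rw [h.lt_iff i j i' j' hij hij', h'.lt_iff j l j' l' hjl hjl']

theorem of_dvd (h : HoleMatching p x y M) {q : ℕ} (hpq : p ∣ q) : HoleMatching q x y M := by
  obtain ⟨c, rfl⟩ := hpq
  refine ⟨fun i j hij k => ?_, fun i => ?_, fun j => ?_, fun i j hij k => ?_, h.lt_iff⟩
  · push_cast
    simpa only [mul_assoc] using h.add_mul i j hij (c * k)
  · exact (h.left_total i).imp_left fun hi => Per_subset_of_dvd (Nat.dvd_mul_right p c) x hi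
  · exact (h.right_total j).imp_left fun hj => Per_subset_of_dvd (Nat.dvd_mul_right p c) y hj
  · push_cast
    simpa only [mul_assoc] using h.eq_iff i j hij (c * k)

theorem seqShift_right (h : HoleMatching p x y M) (n : ℤ) :
    HoleMatching p x (seqShift n y) (fun i j => M i (j + n)) where
  add_mul i j hij k := by
    simpa only [add_right_comm] using h.add_mul i (j + n) hij k
  left_total i := (h.left_total i).imp_right fun ⟨j, hj⟩ => ⟨j - n, by simpa using hj⟩
  right_total j := by simpa only [mem_Per_seqShift] using h.right_total (j + n)
  eq_iff i j hij k := by simpa only [seqShift_apply, add_right_comm] using h.eq_iff i (j + n) hij k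
  lt_iff i j i' j' hij hij' := by
    rw [h.lt_iff i (j + n) i' (j' + n) hij hij']
    exact add_lt_add_iff_right n

theorem seqShift_mul (h : HoleMatching p x y M) (k : ℤ) :
    HoleMatching p (seqShift (p * k) x) (seqShift (p * k) y) M where
  add_mul := h.add_mul
  left_total i := by
    rw [mem_Per_seqShift, add_mul_mem_Per_iff]
    exact h.left_total i
  right_total j := by
    rw [mem_Per_seqShift, add_mul_mem_Per_iff]
    exact h.right_total j
  eq_iff i j hij l := by
    simpa only [seqShift_apply, add_right_comm] using
      h.eq_iff _ _ (h.add_mul i j hij k) l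
  lt_iff := h.lt_iff

theorem right_unique (h : HoleMatching p x y M) {i j j' : ℤ} (hj : M i j) (hj' : M i j') :
    j = j' := by
  have h1 := h.lt_iff i j i j' hj hj'
  have h2 := h.lt_iff i j' i j hj' hj
  omega

theorem exists_eq_periodicRel (h : HoleMatching p x y M) (hp : 1 ≤ p) :
    ∃ G : Finset (ℤ × ℤ), M = periodicRel p G := by
  have hp0 : (0 : ℤ) < p := by exact_mod_cast hp
  have hfin : {g : ℤ × ℤ | M g.1 g.2 ∧ g.1 ∈ Ico (0 : ℤ) p}.Finite := by
    refine Finite.of_finite_image ((finite_Ico (0 : ℤ) p).subset ?_)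
      (f := Prod.fst) ?_
    · rintro _ ⟨g, hg, rfl⟩
      exact hg.2
    · rintro ⟨i, j⟩ hg ⟨i', j'⟩ hg' (rfl : i = i')
      exact Prod.ext rfl (h.right_unique hg.1 hg'.1)
  refine ⟨hfin.toFinset, ?_⟩
  ext i j
  simp only [periodicRel, Finite.mem_toFinset, mem_ofPred_eq]
  constructor
  · intro hij
    have hi := Int.emod_add_mul_ediv i p
    refine ⟨(i + p * (-(i / p)), j + p * (-(i / p))), ⟨h.add_mul i j hij _, ?_⟩, i / p, ?_, ?_⟩
    · have h0 := Int.emod_nonneg i hp0.ne'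
      have h1 := Int.emod_lt_of_pos i hp0
      constructor <;> simp only <;> linarith
    · simp only; ring
    · simp only; ring
  · rintro ⟨⟨i', j'⟩, ⟨hg, -⟩, k, rfl, rfl⟩
    exact h.add_mul i' j' hg k

theorem isClosed_setOf [TopologicalSpace A] [DiscreteTopology A] (p : ℕ) (M : ℤ → ℤ → Prop)
    {c : (ℤ → A) → ℤ → A} (hc : Continuous c) :
    IsClosed {x : ℤ → A | HoleMatching p x (c x) M} := by
  have hcl : ∀ i j k : ℤ, IsClosed {x : ℤ → A | x (i + p * k) = x i ↔ c x (j + p * k) = c x j} := by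
    intro i j k
    let f : (ℤ → A) → (A × A) × A × A := fun x => ((x (i + p * k), x i), c x (j + p * k), c x j)
    have hf : Continuous f := by fun_prop
    exact (isClosed_discrete {q : (A × A) × A × A | q.1.1 = q.1.2 ↔ q.2.1 = q.2.2}).preimage hf
  have : {x : ℤ → A | HoleMatching p x (c x) M} =
      ({_x | ∀ i j, M i j → ∀ k : ℤ, M (i + p * k) (j + p * k)} ∩
        (⋂ i, ({x | i ∈ Per A p x} ∪ {_x | ∃ j, M i j})) ∩
        (⋂ j, (c ⁻¹' {y | j ∈ Per A p y} ∪ {_x | ∃ i, M i j})) ∩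
        (⋂ (i : ℤ) (j : ℤ) (_ : M i j) (k : ℤ),
          {x | x (i + p * k) = x i ↔ c x (j + p * k) = c x j}) ∩
        {_x | ∀ i j i' j', M i j → M i' j' → (i < i' ↔ j < j')}) := by
    ext x
    simp only [mem_inter_iff, mem_iInter, mem_union, mem_ofPred_eq, mem_preimage]
    exact ⟨fun h => ⟨⟨⟨⟨h.1, h.2⟩, h.3⟩, h.4⟩, h.5⟩, fun ⟨⟨⟨⟨h1, h2⟩, h3⟩, h4⟩, h5⟩ =>
      ⟨h1, h2, h3, h4, h5⟩⟩
  rw [this]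
  refine ((((isClosed_const).inter (isClosed_iInter fun i => ?_)).inter
    (isClosed_iInter fun j => ?_)).inter ?_).inter isClosed_const
  · exact (isClosed_setOf_mem_Per p i).union isClosed_const
  · exact ((isClosed_setOf_mem_Per p j).preimage hc).union isClosed_const
  · exact isClosed_iInter fun i => isClosed_iInter fun j => isClosed_iInter fun _ =>
      isClosed_iInter fun k => hcl i j k

theorem exists_map (h : HoleMatching p x y M) {i j : ℤ} (hij : M i j) :
    ∃ f : A → A, ∀ k : ℤ, y (j + p * k) = f (x (i + p * k)) := by
  have : Nonempty A := ⟨x 0⟩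
  have hfac : Function.FactorsThrough (fun k : ℤ => y (j + p * k)) (fun k => x (i + p * k)) := by
    intro k l hkl
    have := h.eq_iff _ _ (h.add_mul i j hij l) (k - l)
    simp only [add_assoc, ← mul_add, add_sub_cancel] at this
    exact this.1 hkl
  obtain ⟨f, hf⟩ := (Function.factorsThrough_iff _).1 hfac
  exact ⟨f, fun k => congr_fun hf k⟩

/-- Up to translation, only finitely many sequences are matched with a given one. -/
theorem finite_setOf [Finite A] (hp : 1 ≤ p) (x : ℤ → A) (i₀ : ℤ) :
    {y : ℤ → A | ∃ M, HoleMatching p x y M ∧ M i₀ 0}.Finite := by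
  have hp0 : (0 : ℤ) < p := by exact_mod_cast hp
  let Ψ : (Ico (0 : ℤ) p → Ico (0 : ℤ) p × (A → A)) → ℤ → A := fun D n =>
    (D ⟨n % p, Int.emod_nonneg n hp0.ne', Int.emod_lt_of_pos n hp0⟩).2
      (x (i₀ + (D ⟨n % p, Int.emod_nonneg n hp0.ne', Int.emod_lt_of_pos n hp0⟩).1 + p * (n / p)))
  refine (finite_range Ψ).subset ?_
  rintro y ⟨M, h, h0⟩
  have hD : ∀ j : Ico (0 : ℤ) p, ∃ D : Ico (0 : ℤ) p × (A → A),
      ∀ k : ℤ, y (j + p * k) = D.2 (x (i₀ + D.1 + p * k)) := by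
    rintro ⟨j, hj0, hjp⟩
    rcases h.right_total j with hj | ⟨i, hij⟩
    · exact ⟨(⟨0, le_rfl, hp0⟩, fun _ => y j), hj⟩
    · obtain ⟨f, hf⟩ := h.exists_map hij
      have h1 := h.lt_iff i j i₀ 0 hij h0
      have h2 := h.lt_iff i j _ _ hij (h.add_mul _ _ h0 1)
      refine ⟨(⟨i - i₀, ?_, ?_⟩, f), fun k => ?_⟩
      · linarith [not_lt.1 (mt h1.1 (not_lt.2 hj0))]
      · linarith [h2.2 (by linarith)]
      · simp [hf]
  choose D hD using hD
  refine ⟨D, funext fun n => ?_⟩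
  have := hD ⟨n % p, Int.emod_nonneg n hp0.ne', Int.emod_lt_of_pos n hp0⟩ (n / p)
  simp only [Int.emod_add_mul_ediv] at this
  exact this.symm

/-- A sliding block code whose radius is small compared with the distance between holes
induces a matching of holes. -/
theorem of_local {r : ℕ} (hx : HolesSeparated (2 * r + 1) p x) (hy : HolesSeparated (2 * r + 1) p y)
    (hxy : ∀ i j : ℤ, (∀ l : ℤ, |l| ≤ r → x (i + l) = x (j + l)) → y i = y j)
    (hyx : ∀ i j : ℤ, (∀ l : ℤ, |l| ≤ r → y (i + l) = y (j + l)) → x i = x j) :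
    HoleMatching p x y (fun i j => i ∉ Per A p x ∧ j ∉ Per A p y ∧ |i - j| ≤ r) := by
  have total : ∀ {x y : ℤ → A}, (∀ i j : ℤ, (∀ l : ℤ, |l| ≤ r → y (i + l) = y (j + l)) →
      x i = x j) → ∀ i, i ∉ Per A p x → ∃ j, j ∉ Per A p y ∧ |i - j| ≤ r := by
    intro x y hyx i hi
    by_contra! hcon
    refine hi fun k => hyx _ _ fun l hl => ?_
    have hmem : i + l ∈ Per A p y := by
      by_contra hmem
      have := hcon _ hmem
      rw [show i - (i + l) = -l by ring, abs_neg] at this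
      omega
    rw [add_right_comm]
    exact hmem k
  have imp : ∀ {x y : ℤ → A}, HolesSeparated (2 * r + 1) p x →
      (∀ i j : ℤ, (∀ l : ℤ, |l| ≤ r → x (i + l) = x (j + l)) → y i = y j) →
      ∀ i j, i ∉ Per A p x → |i - j| ≤ r → ∀ k : ℤ, x (i + p * k) = x i → y (j + p * k) = y j := by
    intro x y hx hxy i j hi hij k hk
    refine hxy _ _ fun l hl => ?_
    rw [add_right_comm]
    by_cases hil : j + l = i
    · rw [hil, hk]
    · have hmem : j + l ∈ Per A p x := by
        by_contra hmem
        have := hx _ _ hil hmem hi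
        rw [abs_le] at hij hl
        have h2 : |j + l - i| ≤ 2 * r :=
          abs_le.2 ⟨by linarith [hij.2, hl.1], by linarith [hij.1, hl.2]⟩
        linarith
      exact hmem k
  have lt_imp : ∀ {x y : ℤ → A}, HolesSeparated (2 * r + 1) p x → ∀ i j i' j' : ℤ,
      i ∉ Per A p x → i' ∉ Per A p x → |i - j| ≤ r → |i' - j'| ≤ r → i < i' → j < j' := by
    intro x y hx i j i' j' hi hi' hij hij' hlt
    have := hx i' i hlt.ne' hi' hi
    rw [abs_of_pos (by linarith)] at this
    rw [abs_le] at hij hij'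
    linarith [hij.1, hij'.2]
  refine ⟨fun i j ⟨hi, hj, hij⟩ k => ⟨?_, ?_, ?_⟩, fun i => ?_, fun j => ?_,
    fun i j ⟨hi, hj, hij⟩ k => ⟨?_, ?_⟩, fun i j i' j' ⟨hi, hj, hij⟩ ⟨hi', hj', hij'⟩ => ⟨?_, ?_⟩⟩
  · rwa [add_mul_mem_Per_iff]
  · rwa [add_mul_mem_Per_iff]
  · simpa using hij
  · refine or_iff_not_imp_left.2 fun hi => ?_
    obtain ⟨j, hj, hij⟩ := total hyx i hi
    exact ⟨j, hi, hj, hij⟩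
  · refine or_iff_not_imp_left.2 fun hj => ?_
    obtain ⟨i, hi, hij⟩ := total hxy j hj
    exact ⟨i, hi, hj, by rwa [abs_sub_comm]⟩
  · exact imp hx hxy i j hi hij k
  · exact imp hy hyx j i hj (by rwa [abs_sub_comm]) k
  · exact lt_imp (y := y) hx i j i' j' hi hi' hij hij'
  · exact lt_imp (y := x) hy j i j' i' hj hj' (by rwa [abs_sub_comm]) (by rwa [abs_sub_comm])

end HoleMatching

end HoleMatching

section SlidingBlockCode

variable {A : Type}

/-- The sliding block code of radius `r` with local rule `g`. -/
def codeMap (r : ℕ) (g : (Finset.Icc (-(r : ℤ)) r → A) → A) (x : ℤ → A) : ℤ → A :=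
  fun i => g (window r (seqShift i x))

theorem codeMap_seqShift (r : ℕ) (g : (Finset.Icc (-(r : ℤ)) r → A) → A) (n : ℤ) (x : ℤ → A) :
    codeMap r g (seqShift n x) = seqShift n (codeMap r g x) := by
  ext i
  simp only [codeMap, seqShift_seqShift, seqShift_apply]

theorem continuous_codeMap [TopologicalSpace A] [DiscreteTopology A] (r : ℕ)
    (g : (Finset.Icc (-(r : ℤ)) r → A) → A) : Continuous (codeMap r g) :=
  continuous_pi fun i =>
    (continuous_of_discreteTopology (f := g)).comp
      ((continuous_window r).comp (continuous_seqShift i))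

variable {K : Set (ℤ → A)} {f : K → ℤ → A}

theorem map_seqShift (hK : ∀ x ∈ K, seqShift 1 x ∈ K)
    (hf : ∀ x y : K, (y : ℤ → A) = shiftMap A x → f y = shiftMap A (f x)) (n : ℤ) (x y : K)
    (hxy : (y : ℤ → A) = seqShift n x) : f y = seqShift n (f x) := by
  have hmem : ∀ (n : ℕ) (x : K), seqShift n (x : ℤ → A) ∈ K ∧
      ∀ y : K, (y : ℤ → A) = seqShift n x → f y = seqShift n (f x) := by
    intro n x
    induction n with
    | zero =>
      refine ⟨by simp, fun y hy => ?_⟩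
      rw [Subtype.ext (hy.trans (by simp) : (y : ℤ → A) = x)]
      simp
    | succ n ih =>
      have hs : ∀ z : ℤ → A, seqShift ((n + 1 : ℕ) : ℤ) z = shiftMap A (seqShift n z) := by
        intro z
        change _ = seqShift 1 (seqShift n z)
        rw [seqShift_seqShift]
        push_cast
        rw [add_comm]
      refine ⟨by rw [hs]; exact hK _ ih.1, fun y hy => ?_⟩
      rw [hs] at hy ⊢
      rw [hf ⟨_, ih.1⟩ y hy, ih.2 ⟨_, ih.1⟩ rfl]
  obtain ⟨k, rfl | rfl⟩ := n.eq_nat_or_neg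
  · exact (hmem k x).2 y hxy
  · rw [(hmem k y).2 x (by rw [hxy, seqShift_seqShift]; simp), seqShift_seqShift]
    simp

variable [TopologicalSpace A] [DiscreteTopology A]

theorem exists_radius_at_zero (hK : IsCompact K) (hf : Continuous f) :
    ∃ r : ℕ, ∀ x y : K, window r (x : ℤ → A) = window r y → f x 0 = f y 0 := by
  by_contra! hcon
  choose x y hxy hne using hcon
  have : CompactSpace K := isCompact_iff_compactSpace.1 hK
  obtain ⟨⟨a, b⟩, -, hab⟩ := (isCompact_univ (X := K × K)).exists_mapClusterPt (f := atTop)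
    (u := fun r => (x r, y r)) (by simp)
  have hne' : f a 0 ≠ f b 0 := by
    have hcl : IsClosed {q : K × K | f q.1 0 ≠ f q.2 0} := by
      have hc : Continuous fun q : K × K => (f q.1 0, f q.2 0) := by fun_prop
      exact (isClosed_discrete {q : A × A | q.1 ≠ q.2}).preimage hc
    exact hcl.mem_of_mapClusterPt hab (Eventually.of_forall hne)
  refine hne' ?_
  have heq : a = b := by
    refine Subtype.ext (funext fun i => ?_)
    have hcl : IsClosed {q : K × K | (q.1 : ℤ → A) i = (q.2 : ℤ → A) i} :=
      isClosed_eq ((continuous_apply i).comp (continuous_subtype_val.comp continuous_fst))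
        ((continuous_apply i).comp (continuous_subtype_val.comp continuous_snd))
    refine hcl.mem_of_mapClusterPt hab ?_
    filter_upwards [eventually_ge_atTop i.natAbs] with r hr
    exact window_eq_iff.1 (hxy r) i (by rw [Int.abs_eq_natAbs]; exact_mod_cast hr)
  rw [heq]

/-- Curtis–Hedlund–Lyndon: a continuous shift-commuting map is locally determined. -/
theorem exists_radius (hK : IsCompact K) (hinv : ∀ x ∈ K, ∀ n : ℤ, seqShift n x ∈ K)
    (hfc : Continuous f)
    (hf : ∀ x y : K, (y : ℤ → A) = shiftMap A x → f y = shiftMap A (f x)) :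
    ∃ r : ℕ, ∀ (x y : K) (i j : ℤ),
      window r (seqShift i (x : ℤ → A)) = window r (seqShift j y) → f x i = f y j := by
  obtain ⟨r, hr⟩ := exists_radius_at_zero hK hfc
  refine ⟨r, fun x y i j h => ?_⟩
  have := hr ⟨_, hinv x x.2 i⟩ ⟨_, hinv y y.2 j⟩ h
  rw [map_seqShift (fun x hx => hinv x hx 1) hf i x ⟨_, hinv x x.2 i⟩ rfl,
    map_seqShift (fun x hx => hinv x hx 1) hf j y ⟨_, hinv y y.2 j⟩ rfl] at this
  simpa using this

theorem exists_eq_codeMap (hne : K.Nonempty) (hK : IsCompact K)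
    (hinv : ∀ x ∈ K, ∀ n : ℤ, seqShift n x ∈ K) (hfc : Continuous f)
    (hf : ∀ x y : K, (y : ℤ → A) = shiftMap A x → f y = shiftMap A (f x)) :
    ∃ (r : ℕ) (g : (Finset.Icc (-(r : ℤ)) r → A) → A), ∀ x : K, f x = codeMap r g x := by
  obtain ⟨r, hr⟩ := exists_radius hK hinv hfc hf
  have : Nonempty A := ⟨hne.some 0⟩
  have hfac : Function.FactorsThrough (fun q : K × ℤ => f q.1 q.2)
      (fun q => window r (seqShift q.2 (q.1 : ℤ → A))) := fun q q' h => hr _ _ _ _ h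
  obtain ⟨g, hg⟩ := (Function.factorsThrough_iff _).1 hfac
  exact ⟨r, g, fun x => funext fun i => congr_fun hg (x, i)⟩

end SlidingBlockCode

section MatchedConj

variable {A : Type}

/-- Conjugacy through a map that matches the `p`-holes of every point with those of its image. -/
def MatchedConj [TopologicalSpace A] (p : ℕ) (K L : Set (ℤ → A)) : Prop :=
  ∃ e : K ≃ₜ L, (∀ x y : K, (y : ℤ → A) = shiftMap A x → (e y : ℤ → A) = shiftMap A (e x)) ∧
    ∀ x : K, ∃ M, HoleMatching p (x : ℤ → A) (e x) M

namespace MatchedConj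

variable [TopologicalSpace A] {p : ℕ} {K L J : Set (ℤ → A)}

theorem isTopConj (h : MatchedConj p K L) : IsTopConj A K L := h.imp fun _ he => he.1

theorem refl (p : ℕ) (K : Set (ℤ → A)) : MatchedConj p K K :=
  ⟨Homeomorph.refl K, fun _ _ h => h, fun x => ⟨_, HoleMatching.refl p (x : ℤ → A)⟩⟩

theorem symm_equivariant (hK : ∀ x ∈ K, seqShift 1 x ∈ K) {e : K ≃ₜ L}
    (he : ∀ x y : K, (y : ℤ → A) = shiftMap A x → (e y : ℤ → A) = shiftMap A (e x)) (x y : L)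
    (hxy : (y : ℤ → A) = shiftMap A x) : (e.symm y : ℤ → A) = shiftMap A (e.symm x) := by
  have h := he (e.symm x) ⟨_, hK _ (e.symm x).2⟩ rfl
  rw [e.apply_symm_apply, ← hxy] at h
  rw [← Subtype.ext h, e.symm_apply_apply]
  rfl

theorem symm (hK : ∀ x ∈ K, seqShift 1 x ∈ K) (h : MatchedConj p K L) : MatchedConj p L K := by
  obtain ⟨e, he, hM⟩ := h
  refine ⟨e.symm, symm_equivariant hK he, fun y => ?_⟩
  obtain ⟨M, hM⟩ := hM (e.symm y)
  rw [e.apply_symm_apply] at hM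
  exact ⟨_, hM.symm⟩

theorem trans (h : MatchedConj p K L) (h' : MatchedConj p L J) : MatchedConj p K J := by
  obtain ⟨e, he, hM⟩ := h
  obtain ⟨e', he', hM'⟩ := h'
  refine ⟨e.trans e', fun x y hxy => he' _ _ (he x y hxy), fun x => ?_⟩
  obtain ⟨M, hM⟩ := hM x
  obtain ⟨M', hM'⟩ := hM' (e x)
  exact ⟨_, hM.comp hM'⟩

theorem of_dvd (h : MatchedConj p K L) {q : ℕ} (hpq : p ∣ q) : MatchedConj q K L := by
  obtain ⟨e, he, hM⟩ := h
  exact ⟨e, he, fun x => (hM x).imp fun M hM => hM.of_dvd hpq⟩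

variable [DiscreteTopology A]

/-- Any conjugacy matches holes at all sufficiently large factorial levels. -/
theorem exists_of_isTopConj (hK : IsSeparatedMinimal K) (hL : IsSeparatedMinimal L)
    (hKc : IsCompact K) (hLc : IsCompact L)
    (h : IsTopConj A K L) : ∃ n : ℕ, MatchedConj n.factorial K L := by
  obtain ⟨e, he⟩ := h
  obtain ⟨r, hr⟩ := exists_radius (f := fun x => (e x : ℤ → A)) hKc
    (fun x hx => hK.seqShift_mem hKc.isClosed hx) (continuous_subtype_val.comp e.continuous) he
  obtain ⟨r', hr'⟩ := exists_radius (f := fun x => (e.symm x : ℤ → A)) hLc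
    (fun x hx => hL.seqShift_mem hLc.isClosed hx) (continuous_subtype_val.comp e.symm.continuous)
    (symm_equivariant hK.shift_mem he)
  obtain ⟨n, hn⟩ := hK.separated (2 * (max r r' : ℕ) + 1)
  obtain ⟨n', hn'⟩ := hL.separated (2 * (max r r' : ℕ) + 1)
  refine ⟨max n n', e, he, fun x => ⟨_, HoleMatching.of_local (r := max r r')
    ((hn x x.2).of_dvd (Nat.factorial_dvd_factorial (le_max_left _ _)))
    ((hn' _ (e x).2).of_dvd (Nat.factorial_dvd_factorial (le_max_right _ _))) ?_ ?_⟩⟩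
  · refine fun i j hij => hr x x i j (window_eq_iff.2 fun l hl => ?_)
    simp only [seqShift_apply, add_comm l]
    exact hij l (hl.trans (by exact_mod_cast le_max_left _ _))
  · intro i j hij
    have := hr' (e x) (e x) i j (window_eq_iff.2 fun l hl => by
      simp only [seqShift_apply, add_comm l]
      exact hij l (hl.trans (by exact_mod_cast le_max_right _ _)))
    simpa using this

theorem finite_setOf [Finite A] (hp : 1 ≤ p) (hK : IsSeparatedMinimal K) :
    {L : Set (ℤ → A) | (IsClosed L ∧ IsSeparatedMinimal L) ∧ MatchedConj p K L}.Finite := by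
  obtain ⟨x, hx, i, hi⟩ := hK.aperiodic p hp
  have hhole : i ∉ Per A p x := fun h => hi (by simpa using h 1)
  refine ((HoleMatching.finite_setOf hp x i).image (orbitClosure A)).subset ?_
  rintro L ⟨⟨hLc, hL⟩, e, he, hM⟩
  obtain ⟨M, hM⟩ := hM ⟨x, hx⟩
  obtain ⟨j, hij⟩ := (hM.left_total i).resolve_left hhole
  refine ⟨_, ⟨_, hM.seqShift_right j, by simpa using hij⟩, ?_⟩
  exact (hL.eq_orbitClosure hLc (hL.seqShift_mem hLc (e ⟨x, hx⟩).2 j)).symm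

/-- Matched conjugacies are given by pairs of mutually inverse sliding block codes together with
finite data describing the matchings. -/
theorem iff_exists_codeMap (hp : 1 ≤ p) (hK : IsSeparatedMinimal K) (hL : IsSeparatedMinimal L)
    (hKc : IsCompact K) (hLc : IsCompact L)
    (hne : K.Nonempty) :
    MatchedConj p K L ↔ ∃ (r s : ℕ) (g : (Finset.Icc (-(r : ℤ)) r → A) → A)
      (h : (Finset.Icc (-(s : ℤ)) s → A) → A) (𝒢 : Finset (Finset (ℤ × ℤ))),
      (∀ x ∈ K, codeMap r g x ∈ L) ∧ (∀ y ∈ L, codeMap s h y ∈ K) ∧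
      (∀ x ∈ K, codeMap s h (codeMap r g x) = x) ∧ (∀ y ∈ L, codeMap r g (codeMap s h y) = y) ∧
      ∀ x ∈ K, ∃ G ∈ 𝒢, HoleMatching p x (codeMap r g x) (periodicRel p G) := by
  classical
  constructor
  · rintro ⟨e, he, hM⟩
    have hLne : L.Nonempty := ⟨_, (e ⟨_, hne.some_mem⟩).2⟩
    obtain ⟨r, g, hg⟩ := exists_eq_codeMap (f := fun x => (e x : ℤ → A)) hne hKc
      (fun x hx => hK.seqShift_mem hKc.isClosed hx) (continuous_subtype_val.comp e.continuous) he
    obtain ⟨s, h, hh⟩ := exists_eq_codeMap (f := fun x => (e.symm x : ℤ → A)) hLne hLc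
      (fun x hx => hL.seqShift_mem hLc.isClosed hx) (continuous_subtype_val.comp e.symm.continuous)
      (symm_equivariant hK.shift_mem he)
    obtain ⟨x₀, hx₀⟩ := hne
    have hG : ∀ a : ℤ, ∃ G, HoleMatching p (seqShift a x₀) (codeMap r g (seqShift a x₀))
        (periodicRel p G) := by
      intro a
      obtain ⟨M, hM⟩ := hM ⟨_, hK.seqShift_mem hKc.isClosed hx₀ a⟩
      obtain ⟨G, rfl⟩ := hM.exists_eq_periodicRel hp
      rw [hg] at hM
      exact ⟨G, hM⟩
    choose G hG using hG
    refine ⟨r, s, g, h, (Finset.range p).image fun a : ℕ => G a, fun x hx => ?_, fun y hy => ?_,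
      fun x hx => ?_, fun y hy => ?_, fun x hx => ?_⟩
    · rw [← hg ⟨x, hx⟩]
      exact (e _).2
    · rw [← hh ⟨y, hy⟩]
      exact (e.symm _).2
    · rw [← hg ⟨x, hx⟩, ← hh, e.symm_apply_apply]
    · rw [← hh ⟨y, hy⟩, ← hg, e.apply_symm_apply]
    · rw [hK.eq_orbitClosure hKc.isClosed hx₀, orbitClosure_eq] at hx
      simp only [Finset.mem_image, Finset.mem_range, exists_exists_and_eq_and]
      have hcl : IsClosed {x : ℤ → A | ∃ a < p,
          HoleMatching p x (codeMap r g x) (periodicRel p (G a))} := by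
        have : {x : ℤ → A | ∃ a < p, HoleMatching p x (codeMap r g x) (periodicRel p (G a))} =
            ⋃ a ∈ Finset.range p,
              {x | HoleMatching p x (codeMap r g x) (periodicRel p (G (a : ℕ)))} := by
          ext x; simp
        rw [this]
        exact isClosed_biUnion_finset fun a _ =>
          HoleMatching.isClosed_setOf p _ (continuous_codeMap r g)
      refine closure_minimal ?_ hcl hx
      rintro _ ⟨n, rfl⟩
      refine ⟨n % p, Nat.mod_lt _ hp, ?_⟩
      have := (hG (n % p : ℕ)).seqShift_mul (n / p : ℕ)
      rw [← codeMap_seqShift, seqShift_seqShift] at this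
      convert this using 2 <;> norm_cast <;> rw [Nat.div_add_mod]
  · rintro ⟨r, s, g, h, 𝒢, h1, h2, h3, h4, h5⟩
    refine ⟨⟨⟨fun x => ⟨_, h1 x x.2⟩, fun y => ⟨_, h2 y y.2⟩, fun x => Subtype.ext (h3 x x.2),
      fun y => Subtype.ext (h4 y y.2)⟩, ?_, ?_⟩, fun x y hxy => ?_, fun x => ?_⟩
    · exact ((continuous_codeMap r g).comp continuous_subtype_val).subtype_mk _
    · exact ((continuous_codeMap s h).comp continuous_subtype_val).subtype_mk _
    · change codeMap r g y = seqShift 1 (codeMap r g x)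
      rw [hxy, ← codeMap_seqShift]
      rfl
    · obtain ⟨G, -, hG⟩ := h5 x x.2
      exact ⟨_, hG⟩

end MatchedConj

end MatchedConj

section Measurability

variable {A : Type} [MetricSpace A]

theorem measurableSet_subset {Ω : Type*} [MeasurableSpace Ω] {K : Ω → NonemptyCompacts (ℤ → A)}
    (hK : Measurable K) {C : Set (ℤ → A)} (hC : IsClosed C) :
    MeasurableSet {ω | (K ω : Set (ℤ → A)) ⊆ C} := by
  have : BorelSpace (NonemptyCompacts (ℤ → A)) := ⟨rfl⟩
  exact hK (NonemptyCompacts.isClosed_subsets_of_isClosed hC).measurableSet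

variable [Fintype A]

theorem measurableSet_mapsTo {Ω : Type*} [MeasurableSpace Ω] {K L : Ω → NonemptyCompacts (ℤ → A)}
    (hK : Measurable K) (hL : Measurable L) {c : (ℤ → A) → ℤ → A} (hc : Continuous c) :
    MeasurableSet {ω | ∀ x ∈ K ω, c x ∈ L ω} := by
  have hcl : ∀ (m : ℕ) (w : Finset.Icc (-(m : ℤ)) m → A), IsClosed {x | window m x ≠ w} :=
    fun m w => (isClosed_discrete {v | v ≠ w}).preimage (continuous_window m)
  have : {ω | ∀ x ∈ K ω, c x ∈ L ω} = ⋂ (m : ℕ) (w : Finset.Icc (-(m : ℤ)) m → A),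
      ({ω | (K ω : Set (ℤ → A)) ⊆ c ⁻¹' {x | window m x ≠ w}} ∪
        {ω | (L ω : Set (ℤ → A)) ⊆ {x | window m x ≠ w}}ᶜ) := by
    ext ω
    simp only [mem_iInter, mem_union, mem_compl_iff, mem_ofPred_eq]
    constructor
    · refine fun h m w => or_iff_not_imp_right.2 fun hw x hx => ?_
      exact not_not.1 hw (h x hx)
    · intro h x hx
      rw [← SetLike.mem_coe, ← (L ω).isCompact.isClosed.closure_eq, mem_closure_iff_window]
      intro m
      by_contra! hcon
      rcases h m (window m (c x)) with h | h
      · exact h hx rfl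
      · exact h hcon
  rw [this]
  exact MeasurableSet.iInter fun m => MeasurableSet.iInter fun w =>
    (measurableSet_subset hK ((hcl m w).preimage hc)).union (measurableSet_subset hL (hcl m w)).compl

theorem measurableSet_isSeparatedMinimal :
    MeasurableSet {K : NonemptyCompacts (ℤ → A) | IsSeparatedMinimal (K : Set (ℤ → A))} := by
  have hcl : ∀ (m : ℕ) (w : Finset.Icc (-(m : ℤ)) m → A), IsClosed {x | window m x ≠ w} :=
    fun m w => (isClosed_discrete {v | v ≠ w}).preimage (continuous_window m)
  have hrec : ∀ (m t : ℕ) (w : Finset.Icc (-(m : ℤ)) m → A),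
      IsClosed {y | ∃ j ≤ t, window m (seqShift (j : ℕ) y) = w} := by
    intro m t w
    have : {y : ℤ → A | ∃ j ≤ t, window m (seqShift (j : ℕ) y) = w} =
        ⋃ j ∈ Finset.range (t + 1), {y | window m (seqShift (j : ℕ) y) = w} := by
      ext y; simp
    rw [this]
    exact isClosed_biUnion_finset fun j _ =>
      isClosed_eq ((continuous_window m).comp (continuous_seqShift _)) continuous_const
  have hper : ∀ p : ℕ, IsClosed {x : ℤ → A | ∀ i : ℤ, x (i + p) = x i} := by
    intro p
    simp only [ofPred_forall]
    exact isClosed_iInter fun i => isClosed_eq (continuous_apply _) (continuous_apply _)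
  have : {K : NonemptyCompacts (ℤ → A) | IsSeparatedMinimal (K : Set (ℤ → A))} =
      {K | ∀ x ∈ K, seqShift 1 x ∈ K} ∩
      (⋂ (m : ℕ) (w : Finset.Icc (-(m : ℤ)) m → A),
        ({K : NonemptyCompacts (ℤ → A) | (K : Set (ℤ → A)) ⊆ {x | window m x ≠ w}} ∪
          ⋃ t : ℕ, {K : NonemptyCompacts (ℤ → A) |
            (K : Set (ℤ → A)) ⊆ {y | ∃ j ≤ t, window m (seqShift (j : ℕ) y) = w}})) ∩
      (⋂ (p : ℕ) (_ : 1 ≤ p), {K : NonemptyCompacts (ℤ → A) |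
        (K : Set (ℤ → A)) ⊆ {x | ∀ i : ℤ, x (i + p) = x i}}ᶜ) ∩
      (⋂ N : ℤ, ⋃ n : ℕ, {K : NonemptyCompacts (ℤ → A) |
        (K : Set (ℤ → A)) ⊆ {x | HolesSeparated N n.factorial x}}) := by
    ext K
    simp only [mem_inter_iff, mem_iInter, mem_iUnion, mem_union, mem_compl_iff, mem_ofPred_eq]
    constructor
    · refine fun h => ⟨⟨⟨h.shift_mem, fun m w => or_iff_not_imp_left.2 fun hw => ?_⟩,
        fun p hp hcon => ?_⟩, fun N => h.separated N⟩
      · obtain ⟨x, hx, hxw⟩ := not_subset.1 hw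
        rw [← not_not.1 hxw]
        exact h.recurrent m x hx
      · obtain ⟨x, hx, i, hi⟩ := h.aperiodic p hp
        exact hi (hcon hx i)
    · rintro ⟨⟨⟨h1, h2⟩, h3⟩, h4⟩
      refine ⟨h1, fun m x hx => ?_, fun p hp => ?_, h4⟩
      · exact (h2 m (window m x)).resolve_left fun h => h hx rfl
      · obtain ⟨x, hx, hxp⟩ := not_subset.1 (h3 p hp)
        exact ⟨x, hx, not_forall.1 hxp⟩
  rw [this]
  refine (((measurableSet_mapsTo measurable_id measurable_id (continuous_seqShift 1)).inter ?_).inter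
    ?_).inter ?_
  · exact MeasurableSet.iInter fun m => MeasurableSet.iInter fun w =>
      (measurableSet_subset measurable_id (hcl m w)).union
        (MeasurableSet.iUnion fun t => measurableSet_subset measurable_id (hrec m t w))
  · exact MeasurableSet.iInter fun p => MeasurableSet.iInter fun _ =>
      (measurableSet_subset measurable_id (hper p)).compl
  · exact MeasurableSet.iInter fun N => MeasurableSet.iUnion fun n =>
      measurableSet_subset measurable_id (isClosed_holesSeparated N _)

theorem measurableSet_matchedConj {p : ℕ} (hp : 1 ≤ p) :
    MeasurableSet {q : ToeplitzSepHoles A × ToeplitzSepHoles A |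
      MatchedConj p (q.1.1 : Set (ℤ → A)) (q.2.1 : Set (ℤ → A))} := by
  have h1 : Measurable fun q : ToeplitzSepHoles A × ToeplitzSepHoles A => q.1.1 :=
    measurable_subtype_coe.comp measurable_fst
  have h2 : Measurable fun q : ToeplitzSepHoles A × ToeplitzSepHoles A => q.2.1 :=
    measurable_subtype_coe.comp measurable_snd
  have : {q : ToeplitzSepHoles A × ToeplitzSepHoles A |
      MatchedConj p (q.1.1 : Set (ℤ → A)) (q.2.1 : Set (ℤ → A))} =
      ⋃ (r : ℕ) (s : ℕ) (g : (Finset.Icc (-(r : ℤ)) r → A) → A)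
        (h : (Finset.Icc (-(s : ℤ)) s → A) → A) (𝒢 : Finset (Finset (ℤ × ℤ))),
      ({q | ∀ x ∈ q.1.1, codeMap r g x ∈ q.2.1} ∩ ({q | ∀ y ∈ q.2.1, codeMap s h y ∈ q.1.1} ∩
      ({q | (q.1.1 : Set (ℤ → A)) ⊆ {x | codeMap s h (codeMap r g x) = x}} ∩
      ({q | (q.2.1 : Set (ℤ → A)) ⊆ {y | codeMap r g (codeMap s h y) = y}} ∩
      {q | (q.1.1 : Set (ℤ → A)) ⊆
        {x | ∃ G ∈ 𝒢, HoleMatching p x (codeMap r g x) (periodicRel p G)}})))) := by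
    ext q
    simp only [mem_iUnion]
    exact MatchedConj.iff_exists_codeMap hp ((mem_toeplitzSepHoles_iff _).1 q.1.2)
      ((mem_toeplitzSepHoles_iff _).1 q.2.2) q.1.1.isCompact q.2.1.isCompact q.1.1.nonempty
  rw [this]
  refine MeasurableSet.iUnion fun r => MeasurableSet.iUnion fun s => MeasurableSet.iUnion fun g =>
    MeasurableSet.iUnion fun h => MeasurableSet.iUnion fun 𝒢 => ?_
  have hg := continuous_codeMap r g
  have hh := continuous_codeMap s h
  have hcl : IsClosed {x : ℤ → A | ∃ G ∈ 𝒢,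
      HoleMatching p x (codeMap r g x) (periodicRel p G)} := by
    have : {x : ℤ → A | ∃ G ∈ 𝒢, HoleMatching p x (codeMap r g x) (periodicRel p G)} =
        ⋃ G ∈ 𝒢, {x | HoleMatching p x (codeMap r g x) (periodicRel p G)} := by
      ext x; simp
    rw [this]
    exact isClosed_biUnion_finset fun G _ => HoleMatching.isClosed_setOf p _ hg
  exact (measurableSet_mapsTo h1 h2 hg).inter ((measurableSet_mapsTo h2 h1 hh).inter
    ((measurableSet_subset h1 (isClosed_eq (hh.comp hg) continuous_id)).inter
    ((measurableSet_subset h2 (isClosed_eq (hg.comp hh) continuous_id)).inter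
    (measurableSet_subset h1 hcl))))

end Measurability

/-- `T*` is a Borel subset of `K(𝔫^ℤ)` and the topological conjugacy relation
on `T*` is hyperfinite: it is the union of an increasing sequence of finite Borel
equivalence relations. -/
theorem stmt0 (A : Type) [Fintype A] [MetricSpace A] (h2 : 2 ≤ Fintype.card A) :
    MeasurableSet (ToeplitzSepHoles A) ∧
    ∃ F : ℕ → ToeplitzSepHoles A → ToeplitzSepHoles A → Prop,
      (∀ n, Equivalence (F n)) ∧
      (∀ n, MeasurableSet {p : ToeplitzSepHoles A × ToeplitzSepHoles A | F n p.1 p.2}) ∧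
      (∀ n O, {O' : ToeplitzSepHoles A | F n O O'}.Finite) ∧
      (∀ n O O', F n O O' → F (n + 1) O O') ∧
      (∀ O O' : ToeplitzSepHoles A,
        (∃ n, F n O O') ↔ IsTopConj A ((O : NonemptyCompacts (ℤ → A)) : Set (ℤ → A))
          ((O' : NonemptyCompacts (ℤ → A)) : Set (ℤ → A))) := by
  have hsm : ∀ O : ToeplitzSepHoles A, IsSeparatedMinimal (O.1 : Set (ℤ → A)) :=
    fun O => (mem_toeplitzSepHoles_iff _).1 O.2
  have hcl : ∀ O : ToeplitzSepHoles A, IsClosed (O.1 : Set (ℤ → A)) :=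
    fun O => O.1.isCompact.isClosed
  refine ⟨?_, fun n O O' => MatchedConj n.factorial (O.1 : Set (ℤ → A)) (O'.1 : Set (ℤ → A)),
    fun n => ⟨fun O => MatchedConj.refl _ _, fun {O _} h => h.symm (hsm O).shift_mem,
      fun h h' => h.trans h'⟩, fun n => measurableSet_matchedConj n.factorial_pos,
    fun n O => ?_, fun n O O' h => h.of_dvd (Nat.factorial_dvd_factorial n.le_succ),
    fun O O' => ⟨fun ⟨_, h⟩ => h.isTopConj, fun h => MatchedConj.exists_of_isTopConj (hsm O)
      (hsm O') O.1.isCompact O'.1.isCompact h⟩⟩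
  · have : ToeplitzSepHoles A =
        {K : NonemptyCompacts (ℤ → A) | IsSeparatedMinimal (K : Set (ℤ → A))} :=
      Set.ext mem_toeplitzSepHoles_iff
    rw [this]
    exact measurableSet_isSeparatedMinimal
  · refine Finite.of_finite_image ((MatchedConj.finite_setOf n.factorial_pos (hsm O)).subset ?_)
      (f := fun O' : ToeplitzSepHoles A => (O'.1 : Set (ℤ → A)))
      (fun O₁ _ O₂ _ h => Subtype.ext (SetLike.coe_injective h))
    rintro _ ⟨O', h, rfl⟩
    exact ⟨⟨hcl O', hsm O'⟩, h⟩
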